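/- Let R be an associative ring with unit and let (A, B) be a hereditary complete cotorsion pair in Mod R. Then: (a) pd_A(A) = pd(A) and id_B(B) = id(B); (b) coresdim_B(Mod R) ≤ pd(A) ≤ coresdim_B(A) + 1; (c) resdim_A(Mod R) ≤ id(B) ≤ resdim_A(B) + 1. -/

import Mathlib

noncomputable section

open CategoryTheory CategoryTheory.Limits Opposite DirectSum

universe u

namespace CotorsionDim

variable {R : Type u} [Ring R]

/-- `Ext^n_R(M,N) = 0`. -/
def ExtZero (M N : ModuleCat.{u} R) (n : ℕ) : Prop :=
  IsZero (((Ext ℤ (ModuleCat.{u} R) n).obj (op M)).obj N)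

/-- A pair of composable maps forms a short exact sequence `0 → A → B → C → 0`. -/
def IsSES {A B C : ModuleCat.{u} R} (f : A ⟶ B) (g : B ⟶ C) : Prop :=
  ∃ w : f ≫ g = 0, (CategoryTheory.ShortComplex.mk f g w).ShortExact

/-- relative projective dimension `pd_𝒳(M)` -/
def rpd (𝒳 : Set (ModuleCat.{u} R)) (M : ModuleCat.{u} R) : ℕ∞ :=
  sInf {n : ℕ∞ | ∀ j : ℕ, n < (j : ℕ∞) → ∀ X ∈ 𝒳, ExtZero M X j}

/-- relative injective dimension `id_𝒳(M)` -/
def rid (𝒳 : Set (ModuleCat.{u} R)) (M : ModuleCat.{u} R) : ℕ∞ :=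
  sInf {n : ℕ∞ | ∀ j : ℕ, n < (j : ℕ∞) → ∀ X ∈ 𝒳, ExtZero X M j}

/-- `pd_𝒳(𝒴)` -/
def rpdClass (𝒳 𝒴 : Set (ModuleCat.{u} R)) : ℕ∞ := ⨆ Y : 𝒴, rpd 𝒳 Y

/-- `id_𝒳(𝒴)` -/
def ridClass (𝒳 𝒴 : Set (ModuleCat.{u} R)) : ℕ∞ := ⨆ Y : 𝒴, rid 𝒳 Y

/-- projective dimension -/
def pd (M : ModuleCat.{u} R) : ℕ∞ := rpd Set.univ M

/-- injective dimension -/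
def idim (M : ModuleCat.{u} R) : ℕ∞ := rid Set.univ M

/-- `pd(𝒴)` -/
def pdClass (𝒴 : Set (ModuleCat.{u} R)) : ℕ∞ := ⨆ Y : 𝒴, pd Y.1

/-- `id(𝒴)` -/
def idClass (𝒴 : Set (ModuleCat.{u} R)) : ℕ∞ := ⨆ Y : 𝒴, idim Y.1

/-- `M` has an `𝒳`-resolution `0 → X_n → ⋯ → X_0 → M → 0` of length `n`. -/
def HasResLen (𝒳 : Set (ModuleCat.{u} R)) : ℕ → ModuleCat.{u} R → Prop
  | 0, M => M ∈ 𝒳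
  | n+1, M => ∃ (K X : ModuleCat.{u} R) (f : K ⟶ X) (g : X ⟶ M),
      X ∈ 𝒳 ∧ IsSES f g ∧ HasResLen 𝒳 n K

/-- `M` has an `𝒳`-coresolution `0 → M → X_0 → ⋯ → X_n → 0` of length `n`. -/
def HasCoresLen (𝒳 : Set (ModuleCat.{u} R)) : ℕ → ModuleCat.{u} R → Prop
  | 0, M => M ∈ 𝒳
  | n+1, M => ∃ (X C : ModuleCat.{u} R) (f : M ⟶ X) (g : X ⟶ C),
      X ∈ 𝒳 ∧ IsSES f g ∧ HasCoresLen 𝒳 n C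

/-- `resdim_𝒳(M)` -/
def resdim (𝒳 : Set (ModuleCat.{u} R)) (M : ModuleCat.{u} R) : ℕ∞ :=
  ⨅ n : {n : ℕ // HasResLen 𝒳 n M}, (n : ℕ∞)

/-- `coresdim_𝒳(M)` -/
def coresdim (𝒳 : Set (ModuleCat.{u} R)) (M : ModuleCat.{u} R) : ℕ∞ :=
  ⨅ n : {n : ℕ // HasCoresLen 𝒳 n M}, (n : ℕ∞)

/-- `resdim_𝒳(𝒴)` -/
def resdimClass (𝒳 𝒴 : Set (ModuleCat.{u} R)) : ℕ∞ := ⨆ Y : 𝒴, resdim 𝒳 Y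

/-- `coresdim_𝒳(𝒴)` -/
def coresdimClass (𝒳 𝒴 : Set (ModuleCat.{u} R)) : ℕ∞ := ⨆ Y : 𝒴, coresdim 𝒳 Y

/-- `𝒳^∧`, the class of modules with a finite `𝒳`-resolution. -/
def resClosure (𝒳 : Set (ModuleCat.{u} R)) : Set (ModuleCat.{u} R) :=
  {M | ∃ n, HasResLen 𝒳 n M}

/-- `𝒳^∨`, the class of modules with a finite `𝒳`-coresolution. -/
def coresClosure (𝒳 : Set (ModuleCat.{u} R)) : Set (ModuleCat.{u} R) :=
  {M | ∃ n, HasCoresLen 𝒳 n M}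

/-- `(𝒜, ℬ)` is a cotorsion pair. -/
def IsCotorsionPair (𝒜 ℬ : Set (ModuleCat.{u} R)) : Prop :=
  (∀ M, M ∈ 𝒜 ↔ ∀ B ∈ ℬ, ExtZero M B 1) ∧
  (∀ M, M ∈ ℬ ↔ ∀ A ∈ 𝒜, ExtZero A M 1)

/-- completeness of a cotorsion pair -/
def IsComplete (𝒜 ℬ : Set (ModuleCat.{u} R)) : Prop :=
  ∀ M : ModuleCat.{u} R,
    (∃ (B A : ModuleCat.{u} R) (f : B ⟶ A) (g : A ⟶ M), B ∈ ℬ ∧ A ∈ 𝒜 ∧ IsSES f g) ∧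
    (∃ (B A : ModuleCat.{u} R) (f : M ⟶ B) (g : B ⟶ A), B ∈ ℬ ∧ A ∈ 𝒜 ∧ IsSES f g)

/-- heredity of a cotorsion pair -/
def IsHereditary (𝒜 ℬ : Set (ModuleCat.{u} R)) : Prop :=
  ∀ i : ℕ, 1 ≤ i → ∀ A ∈ 𝒜, ∀ B ∈ ℬ, ExtZero A B i

variable (R)

/-- `𝒫`, the class of modules of finite projective dimension. -/
def P : Set (ModuleCat.{u} R) := {M | pd M < ⊤}

variable {R}

/-- `M` admits a projective resolution consisting of finitely generated projectives,
i.e. `M ∈ mod R`. -/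
def InmodR (M : ModuleCat.{u} R) : Prop :=
  ∃ K : ℕ → ModuleCat.{u} R, K 0 = M ∧ ∀ i : ℕ,
    ∃ (Q : ModuleCat.{u} R) (f : K (i+1) ⟶ Q) (g : Q ⟶ K i),
      Module.Finite R Q ∧ Projective Q ∧ IsSES f g

variable (R)

/-- `𝒫^{<∞} = 𝒫 ∩ mod R`. -/
def Pfin : Set (ModuleCat.{u} R) := {M | pd M < ⊤ ∧ InmodR M}

/-- the big finitistic dimension -/
def bigFindim : ℕ∞ := pdClass (P R)

/-- the little finitistic dimension -/
def littleFindim : ℕ∞ := pdClass (Pfin R)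

variable {R}

/-- `𝒳^{⊥₁}` -/
def rperp1 (𝒳 : Set (ModuleCat.{u} R)) : Set (ModuleCat.{u} R) :=
  {M | ∀ X ∈ 𝒳, ExtZero X M 1}

/-- `^{⊥₁}𝒳` -/
def lperp1 (𝒳 : Set (ModuleCat.{u} R)) : Set (ModuleCat.{u} R) :=
  {M | ∀ X ∈ 𝒳, ExtZero M X 1}

/-- `T^⊥ = {M : Ext^i(T,M) = 0 for all i > 0}` -/
def rperpAll (T : ModuleCat.{u} R) : Set (ModuleCat.{u} R) :=
  {M | ∀ i : ℕ, 0 < i → ExtZero T M i}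

/-- `Add T`: direct summands of arbitrary direct sums of copies of `T`. -/
def AddT (T : ModuleCat.{u} R) : Set (ModuleCat.{u} R) :=
  {M | ∃ (I : Type u) (s : M ⟶ ModuleCat.of R (I →₀ T)) (r : ModuleCat.of R (I →₀ T) ⟶ M),
    s ≫ r = 𝟙 M}

/-- `T` is a tilting module. -/
def IsTilting (T : ModuleCat.{u} R) : Prop :=
  pd T < ⊤ ∧
  (∀ i : ℕ, 0 < i → ∀ I : Type u, ExtZero T (ModuleCat.of R (I →₀ T)) i) ∧
  ∃ n, HasCoresLen (AddT T) n (ModuleCat.of R R)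


/-- `𝒳` is closed under arbitrary direct sums (coproducts). -/
def ClosedUnderCoproducts (𝒳 : Set (ModuleCat.{u} R)) : Prop :=
  ∀ (I : Type u) (f : I → ModuleCat.{u} R), (∀ i, f i ∈ 𝒳) →
    ModuleCat.of R (⨁ i, (f i : Type u)) ∈ 𝒳

/-- `𝒳` is closed under direct summands. -/
def ClosedUnderSummands (𝒳 : Set (ModuleCat.{u} R)) : Prop :=
  ∀ (M N : ModuleCat.{u} R) (s : M ⟶ N) (r : N ⟶ M), s ≫ r = 𝟙 M → N ∈ 𝒳 → M ∈ 𝒳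

section ExtVanishing

open Abelian

theorem extZero_succ_iff_subsingleton (M N : ModuleCat.{u} R) (n : ℕ) :
    ExtZero M N (n + 1) ↔ Subsingleton (Abelian.Ext.{u} M N (n + 1)) := by
  let Q := projectiveResolution M
  have exact_iff : ExtZero M N (n + 1) ↔ ∀ f : Q.complex.X (n + 1) ⟶ N,
      Q.complex.d (n + 2) (n + 1) ≫ f = 0 →
        ∃ g : Q.complex.X n ⟶ N, Q.complex.d (n + 1) n ≫ g = f := by
    rw [ExtZero, (Q.isoExt (R := ℤ) (n + 1) N).isZero_iff,
      ← HomologicalComplex.exactAt_iff_isZero_homology,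
      HomologicalComplex.exactAt_iff' _ n (n + 1) (n + 2) (by simp) (by simp),
      ShortComplex.moduleCat_exact_iff]
    exact Iff.rfl
  rw [exact_iff]
  constructor
  · intro h
    refine subsingleton_of_forall_eq 0 fun α => ?_
    obtain ⟨f, hf, rfl⟩ := Q.extMk_surjective α (n + 2) rfl
    exact (Q.extMk_eq_zero_iff f (n + 2) rfl hf n rfl).2 (h f hf)
  · intro h f hf
    exact (Q.extMk_eq_zero_iff f (n + 2) rfl hf n rfl).1 (Subsingleton.elim _ _)

variable {X Y Z : ModuleCat.{u} R} {f : X ⟶ Y} {g : Y ⟶ Z}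

theorem IsSES.extZero_right (h : IsSES f g) {M : ModuleCat.{u} R} {n : ℕ}
    (hY : ExtZero M Y (n + 1)) (hX : ExtZero M X (n + 2)) : ExtZero M Z (n + 1) := by
  obtain ⟨w, hS⟩ := h
  rw [extZero_succ_iff_subsingleton] at *
  refine subsingleton_of_forall_eq 0 fun x => ?_
  obtain ⟨y, rfl⟩ := Ext.covariant_sequence_exact₃ M hS x rfl (Subsingleton.elim _ _)
  rw [Subsingleton.elim y 0, Ext.zero_comp]

theorem IsSES.extZero_left (h : IsSES f g) {M : ModuleCat.{u} R} {n : ℕ}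
    (hZ : ExtZero M Z (n + 1)) (hY : ExtZero M Y (n + 2)) : ExtZero M X (n + 2) := by
  obtain ⟨w, hS⟩ := h
  rw [extZero_succ_iff_subsingleton] at *
  refine subsingleton_of_forall_eq 0 fun x => ?_
  obtain ⟨y, rfl⟩ := Ext.covariant_sequence_exact₁ M hS x (Subsingleton.elim _ _) rfl
  rw [Subsingleton.elim y 0, Ext.zero_comp]

theorem IsSES.extZero_of_left (h : IsSES f g) {N : ModuleCat.{u} R} {n : ℕ}
    (hY : ExtZero Y N (n + 1)) (hZ : ExtZero Z N (n + 2)) : ExtZero X N (n + 1) := by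
  obtain ⟨w, hS⟩ := h
  rw [extZero_succ_iff_subsingleton] at *
  refine subsingleton_of_forall_eq 0 fun x => ?_
  obtain ⟨y, rfl⟩ := Ext.contravariant_sequence_exact₁ hS N x (n₁ := n + 2) (by lia)
    (Subsingleton.elim _ _)
  rw [Subsingleton.elim y 0, Ext.comp_zero]

theorem IsSES.extZero_of_right (h : IsSES f g) {N : ModuleCat.{u} R} {n : ℕ}
    (hX : ExtZero X N (n + 1)) (hY : ExtZero Y N (n + 2)) : ExtZero Z N (n + 2) := by
  obtain ⟨w, hS⟩ := h
  rw [extZero_succ_iff_subsingleton] at *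
  refine subsingleton_of_forall_eq 0 fun x => ?_
  obtain ⟨y, rfl⟩ := Ext.contravariant_sequence_exact₃ hS N x (Subsingleton.elim _ _)
    (n₀ := n + 1) (by lia)
  rw [Subsingleton.elim y 0, Ext.comp_zero]

end ExtVanishing

section Dimensions

variable {𝒳 𝒴 : Set (ModuleCat.{u} R)} {M : ModuleCat.{u} R}

theorem rpd_le_iff {n : ℕ∞} :
    rpd 𝒳 M ≤ n ↔ ∀ j : ℕ, n < (j : ℕ∞) → ∀ X ∈ 𝒳, ExtZero M X j := by
  refine ⟨fun h j hj => ?_, fun h => sInf_le h⟩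
  have hmem := csInf_mem (s := {n : ℕ∞ | ∀ j : ℕ, n < (j : ℕ∞) → ∀ X ∈ 𝒳, ExtZero M X j})
    ⟨⊤, fun j hj => absurd hj not_top_lt⟩
  exact hmem j (h.trans_lt hj)

theorem rid_le_iff {n : ℕ∞} :
    rid 𝒳 M ≤ n ↔ ∀ j : ℕ, n < (j : ℕ∞) → ∀ X ∈ 𝒳, ExtZero X M j := by
  refine ⟨fun h j hj => ?_, fun h => sInf_le h⟩
  have hmem := csInf_mem (s := {n : ℕ∞ | ∀ j : ℕ, n < (j : ℕ∞) → ∀ X ∈ 𝒳, ExtZero X M j})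
    ⟨⊤, fun j hj => absurd hj not_top_lt⟩
  exact hmem j (h.trans_lt hj)

theorem rpdClass_le_iff {n : ℕ∞} :
    rpdClass 𝒳 𝒴 ≤ n ↔ ∀ Y ∈ 𝒴, ∀ j : ℕ, n < (j : ℕ∞) → ∀ X ∈ 𝒳, ExtZero Y X j := by
  simp only [rpdClass, iSup_le_iff, rpd_le_iff, Subtype.forall]

theorem ridClass_le_iff {n : ℕ∞} :
    ridClass 𝒳 𝒴 ≤ n ↔ ∀ Y ∈ 𝒴, ∀ j : ℕ, n < (j : ℕ∞) → ∀ X ∈ 𝒳, ExtZero X Y j := by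
  simp only [ridClass, iSup_le_iff, rid_le_iff, Subtype.forall]

theorem pdClass_le_iff {n : ℕ∞} :
    pdClass 𝒴 ≤ n ↔ ∀ Y ∈ 𝒴, ∀ j : ℕ, n < (j : ℕ∞) → ∀ M, ExtZero Y M j := by
  simp only [pdClass, pd, iSup_le_iff, rpd_le_iff, Subtype.forall, Set.mem_univ, forall_const]

theorem idClass_le_iff {n : ℕ∞} :
    idClass 𝒴 ≤ n ↔ ∀ Y ∈ 𝒴, ∀ j : ℕ, n < (j : ℕ∞) → ∀ M, ExtZero M Y j := by
  simp only [idClass, idim, iSup_le_iff, rid_le_iff, Subtype.forall, Set.mem_univ, forall_const]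

theorem coresdim_le_of_hasCoresLen {n : ℕ} (h : HasCoresLen 𝒳 n M) : coresdim 𝒳 M ≤ n :=
  iInf_le (fun m : {m : ℕ // HasCoresLen 𝒳 m M} => (m : ℕ∞)) ⟨n, h⟩

theorem resdim_le_of_hasResLen {n : ℕ} (h : HasResLen 𝒳 n M) : resdim 𝒳 M ≤ n :=
  iInf_le (fun m : {m : ℕ // HasResLen 𝒳 m M} => (m : ℕ∞)) ⟨n, h⟩

theorem exists_hasCoresLen_of_coresdim_lt {n : ℕ∞} (h : coresdim 𝒳 M < n) :
    ∃ m : ℕ, (m : ℕ∞) < n ∧ HasCoresLen 𝒳 m M := by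
  obtain ⟨⟨m, hm⟩, hlt⟩ := iInf_lt_iff.1 h
  exact ⟨m, hlt, hm⟩

theorem exists_hasResLen_of_resdim_lt {n : ℕ∞} (h : resdim 𝒳 M < n) :
    ∃ m : ℕ, (m : ℕ∞) < n ∧ HasResLen 𝒳 m M := by
  obtain ⟨⟨m, hm⟩, hlt⟩ := iInf_lt_iff.1 h
  exact ⟨m, hlt, hm⟩

end Dimensions

section CotorsionPair

variable {𝒜 ℬ : Set (ModuleCat.{u} R)}

theorem rpdClass_self_eq_pdClass (hcomp : IsComplete 𝒜 ℬ) (hher : IsHereditary 𝒜 ℬ) :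
    rpdClass 𝒜 𝒜 = pdClass 𝒜 := by
  apply le_antisymm
  · rw [rpdClass_le_iff]
    exact fun A hA j hj X _ => pdClass_le_iff.1 le_rfl A hA j hj X
  · rw [pdClass_le_iff]
    intro A hA j hj M
    obtain ⟨⟨B, A', f, g, hB, hA', hS⟩, -⟩ := hcomp M
    obtain _ | j := j
    · simp at hj
    · exact hS.extZero_right (rpdClass_le_iff.1 le_rfl A hA _ hj A' hA')
        (hher _ (by lia) A hA B hB)

theorem ridClass_self_eq_idClass (hcomp : IsComplete 𝒜 ℬ) (hher : IsHereditary 𝒜 ℬ) :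
    ridClass ℬ ℬ = idClass ℬ := by
  apply le_antisymm
  · rw [ridClass_le_iff]
    exact fun B hB j hj X _ => idClass_le_iff.1 le_rfl B hB j hj X
  · rw [idClass_le_iff]
    intro B hB j hj M
    obtain ⟨-, ⟨B', A, f, g, hB', hA, hS⟩⟩ := hcomp M
    obtain _ | j := j
    · simp at hj
    · exact hS.extZero_of_left (ridClass_le_iff.1 le_rfl B hB _ hj B' hB')
        (hher _ (by lia) A hA B hB)

theorem hasCoresLen_of_extZero (hcp : IsCotorsionPair 𝒜 ℬ) (hcomp : IsComplete 𝒜 ℬ)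
    (hher : IsHereditary 𝒜 ℬ) {n : ℕ} {M : ModuleCat.{u} R}
    (hM : ∀ A ∈ 𝒜, ExtZero A M (n + 1)) : HasCoresLen ℬ n M := by
  induction n generalizing M with
  | zero => exact (hcp.2 M).2 hM
  | succ n ih =>
    obtain ⟨-, ⟨B, C, f, g, hB, -, hS⟩⟩ := hcomp M
    exact ⟨B, C, f, g, hB, hS, ih fun A hA =>
      hS.extZero_right (hher _ (by lia) A hA B hB) (hM A hA)⟩

theorem hasResLen_of_extZero (hcp : IsCotorsionPair 𝒜 ℬ) (hcomp : IsComplete 𝒜 ℬ)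
    (hher : IsHereditary 𝒜 ℬ) {n : ℕ} {M : ModuleCat.{u} R}
    (hM : ∀ B ∈ ℬ, ExtZero M B (n + 1)) : HasResLen 𝒜 n M := by
  induction n generalizing M with
  | zero => exact (hcp.1 M).2 hM
  | succ n ih =>
    obtain ⟨⟨K, A, f, g, -, hA, hS⟩, -⟩ := hcomp M
    exact ⟨K, A, f, g, hA, hS, ih fun B hB =>
      hS.extZero_of_left (hher _ (by lia) A hA B hB) (hM B hB)⟩

theorem HasCoresLen.extZero (hher : IsHereditary 𝒜 ℬ) {n : ℕ} {M : ModuleCat.{u} R}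
    (hM : HasCoresLen ℬ n M) {j : ℕ} (hj : n < j) {A : ModuleCat.{u} R} (hA : A ∈ 𝒜) :
    ExtZero A M j := by
  induction n generalizing M j with
  | zero => exact hher j hj A hA M hM
  | succ n ih =>
    obtain ⟨B, C, f, g, hB, hS, hC⟩ := hM
    obtain ⟨j, rfl⟩ : ∃ i, j = i + 2 := ⟨j - 2, by lia⟩
    exact hS.extZero_left (ih hC (by lia)) (hher _ (by lia) A hA B hB)

theorem HasResLen.extZero (hher : IsHereditary 𝒜 ℬ) {n : ℕ} {M : ModuleCat.{u} R}
    (hM : HasResLen 𝒜 n M) {j : ℕ} (hj : n < j) {B : ModuleCat.{u} R} (hB : B ∈ ℬ) :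
    ExtZero M B j := by
  induction n generalizing M j with
  | zero => exact hher j hj M hM B hB
  | succ n ih =>
    obtain ⟨K, A, f, g, hA, hS, hK⟩ := hM
    obtain ⟨j, rfl⟩ : ∃ i, j = i + 2 := ⟨j - 2, by lia⟩
    exact hS.extZero_of_right (ih hK (by lia)) (hher _ (by lia) A hA B hB)

theorem coresdimClass_univ_le_pdClass (hcp : IsCotorsionPair 𝒜 ℬ) (hcomp : IsComplete 𝒜 ℬ)
    (hher : IsHereditary 𝒜 ℬ) : coresdimClass ℬ Set.univ ≤ pdClass 𝒜 := by
  refine iSup_le fun M => ?_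
  by_cases htop : pdClass 𝒜 = ⊤
  · simp [htop]
  obtain ⟨n, hn⟩ := ENat.ne_top_iff_exists.1 htop
  rw [← hn]
  refine coresdim_le_of_hasCoresLen (hasCoresLen_of_extZero hcp hcomp hher fun A hA => ?_)
  exact pdClass_le_iff.1 hn.ge A hA _ (by exact_mod_cast n.lt_succ_self) _

theorem resdimClass_univ_le_idClass (hcp : IsCotorsionPair 𝒜 ℬ) (hcomp : IsComplete 𝒜 ℬ)
    (hher : IsHereditary 𝒜 ℬ) : resdimClass 𝒜 Set.univ ≤ idClass ℬ := by
  refine iSup_le fun M => ?_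
  by_cases htop : idClass ℬ = ⊤
  · simp [htop]
  obtain ⟨n, hn⟩ := ENat.ne_top_iff_exists.1 htop
  rw [← hn]
  refine resdim_le_of_hasResLen (hasResLen_of_extZero hcp hcomp hher fun B hB => ?_)
  exact idClass_le_iff.1 hn.ge B hB _ (by exact_mod_cast n.lt_succ_self) _

theorem pdClass_le_coresdimClass (hcomp : IsComplete 𝒜 ℬ) (hher : IsHereditary 𝒜 ℬ) :
    pdClass 𝒜 ≤ coresdimClass ℬ 𝒜 := by
  rw [← rpdClass_self_eq_pdClass hcomp hher, rpdClass_le_iff]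
  intro A hA j hj X hX
  obtain ⟨m, hmj, hm⟩ := exists_hasCoresLen_of_coresdim_lt
    ((le_iSup (fun Y : 𝒜 => coresdim ℬ Y) ⟨X, hX⟩).trans_lt hj)
  exact hm.extZero hher (by exact_mod_cast hmj) hA

theorem idClass_le_resdimClass (hcomp : IsComplete 𝒜 ℬ) (hher : IsHereditary 𝒜 ℬ) :
    idClass ℬ ≤ resdimClass 𝒜 ℬ := by
  rw [← ridClass_self_eq_idClass hcomp hher, ridClass_le_iff]
  intro B hB j hj X hX
  obtain ⟨m, hmj, hm⟩ := exists_hasResLen_of_resdim_lt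
    ((le_iSup (fun Y : ℬ => resdim 𝒜 Y) ⟨X, hX⟩).trans_lt hj)
  exact hm.extZero hher (by exact_mod_cast hmj) hB

end CotorsionPair

/-- Corollary 2.3: dimension (in)equalities for a hereditary complete cotorsion pair. -/
theorem stmt14 {R : Type u} [Ring R] (𝒜 ℬ : Set (ModuleCat.{u} R))
    (hcp : IsCotorsionPair 𝒜 ℬ) (hcomp : IsComplete 𝒜 ℬ) (hher : IsHereditary 𝒜 ℬ) :
    (rpdClass 𝒜 𝒜 = pdClass 𝒜 ∧ ridClass ℬ ℬ = idClass ℬ) ∧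
    (coresdimClass ℬ Set.univ ≤ pdClass 𝒜 ∧ pdClass 𝒜 ≤ coresdimClass ℬ 𝒜 + 1) ∧
    (resdimClass 𝒜 Set.univ ≤ idClass ℬ ∧ idClass ℬ ≤ resdimClass 𝒜 ℬ + 1) :=
  ⟨⟨rpdClass_self_eq_pdClass hcomp hher, ridClass_self_eq_idClass hcomp hher⟩,
    ⟨coresdimClass_univ_le_pdClass hcp hcomp hher,
      (pdClass_le_coresdimClass hcomp hher).trans le_self_add⟩,
    ⟨resdimClass_univ_le_idClass hcp hcomp hher,
      (idClass_le_resdimClass hcomp hher).trans le_self_add⟩⟩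

end CotorsionDim
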